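/- For the elephant random walk remembering the first and the most recent step: (S_n − n(2p−1)X_1/(3−2p))/(σ_T√n) converges in distribution to a standard normal random variable as n → ∞, where σ_T² = 1 + (2p−1)(4p²−24p+19)/(3−2p)³. -/

import Mathlib

open MeasureTheory ProbabilityTheory Filter Topology

noncomputable section

/-- The σ-algebra generated by the steps `X 1, …, X n`. -/
def sigmaUpTo {Ω : Type*} (X : ℕ → Ω → ℝ) (n : ℕ) : MeasurableSpace Ω :=
  ⨆ i ∈ Finset.Icc 1 n, MeasurableSpace.comap (X i) inferInstance

/-- The σ-algebra generated by all the steps `X 1, X 2, …`. -/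
def sigmaAll {Ω : Type*} (X : ℕ → Ω → ℝ) : MeasurableSpace Ω :=
  ⨆ i ∈ Set.Ici 1, MeasurableSpace.comap (X i) inferInstance

/-- The partial sum `X 1 + ⋯ + X n` of the walk. -/
def partialSum {Ω : Type*} (X : ℕ → Ω → ℝ) (n : ℕ) (ω : Ω) : ℝ :=
  ∑ k ∈ Finset.Icc 1 n, X k ω

/-- Convergence in distribution of the random variables `f n` to the law `ν`,
expressed as weak convergence tested against bounded continuous functions. -/
def TendstoInDistribution {Ω : Type*} [MeasurableSpace Ω] (μ : Measure Ω)
    (f : ℕ → Ω → ℝ) (ν : Measure ℝ) : Prop :=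
  ∀ g : BoundedContinuousFunction ℝ ℝ,
    Tendsto (fun n => ∫ ω, g (f n ω) ∂μ) atTop (𝓝 (∫ x, g x ∂ν))

/-- A first-order correction `h(s, x)` making `exp (i t ∑ (X_j - θ s)) h(s, X_k)` an approximate
eigenfunction of the walk started at `s`. -/
def corrector (θ t s x : ℝ) : ℂ :=
  1 + ((t * θ * (x - θ * s) : ℝ) : ℂ) * Complex.I
    + ((t ^ 2 * (θ * (1 + 2 * θ)) * (θ * s) * (x - θ * s) : ℝ) : ℂ)

/-- The approximate eigenvalue, to second order in `t`. -/
def approxEigenvalue (θ t : ℝ) : ℝ := 1 - (1 + 2 * θ) * (1 - θ ^ 2) * t ^ 2 / 2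

lemma abs_sub_mul_le_two {θ s x : ℝ} (hθ : |θ| ≤ 1) (hs : s = 1 ∨ s = -1) (hx : x = 1 ∨ x = -1) :
    |x - θ * s| ≤ 2 := by
  rw [abs_le] at *
  rcases hs with rfl | rfl <;> rcases hx with rfl | rfl <;> constructor <;> linarith

lemma abs_mul_one_add_two_mul_le {θ : ℝ} (hθ : |θ| ≤ 1) : |θ * (1 + 2 * θ)| ≤ 3 := by
  rw [abs_le] at *
  constructor <;> nlinarith

lemma norm_corrector_sub_one_le {θ t s x : ℝ} (hθ : |θ| ≤ 1) (ht : |t| ≤ 1)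
    (hs : s = 1 ∨ s = -1) (hx : x = 1 ∨ x = -1) :
    ‖corrector θ t s x - 1‖ ≤ 8 * |t| := by
  have hy := abs_sub_mul_le_two hθ hs hx
  have hc := abs_mul_one_add_two_mul_le hθ
  have hs1 : |s| = 1 := by rcases hs with rfl | rfl <;> simp
  have e : corrector θ t s x - 1 = ((t * θ * (x - θ * s) : ℝ) : ℂ) * Complex.I
      + ((t ^ 2 * (θ * (1 + 2 * θ)) * (θ * s) * (x - θ * s) : ℝ) : ℂ) := by
    unfold corrector; ring
  rw [e]
  refine (norm_add_le _ _).trans ?_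
  rw [norm_mul, Complex.norm_I, mul_one, Complex.norm_real, Complex.norm_real, Real.norm_eq_abs,
    Real.norm_eq_abs]
  have h1 : |t * θ * (x - θ * s)| ≤ |t| * 1 * 2 := by
    rw [abs_mul, abs_mul]; gcongr
  have h2 : |t ^ 2 * (θ * (1 + 2 * θ)) * (θ * s) * (x - θ * s)| ≤ |t| * 3 * (1 * 1) * 2 := by
    rw [abs_mul, abs_mul, abs_mul, abs_mul θ s, abs_pow, hs1]
    have : |t| ^ 2 ≤ |t| := by nlinarith [abs_nonneg t]
    gcongr
  linarith

lemma abs_approxEigenvalue_le_one {θ t : ℝ} (hθ0 : -1 / 3 ≤ θ) (hθ : |θ| ≤ 1) (ht : |t| ≤ 1) :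
    |approxEigenvalue θ t| ≤ 1 := by
  have ht2 : t ^ 2 ≤ 1 := (sq_le_one_iff_abs_le_one t).2 ht
  have hθ2 : θ ^ 2 ≤ 1 := (sq_le_one_iff_abs_le_one θ).2 hθ
  rw [abs_le] at hθ
  have h0 : 0 ≤ (1 + 2 * θ) * (1 - θ ^ 2) := mul_nonneg (by linarith) (by linarith)
  have h3 : (1 + 2 * θ) * (1 - θ ^ 2) ≤ 3 * 1 :=
    mul_le_mul (by linarith) (by nlinarith) (by linarith) (by norm_num)
  unfold approxEigenvalue
  rw [abs_le]
  constructor <;> nlinarith [sq_nonneg t]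

lemma norm_exp_mul_I_sub_quadratic_le {t y : ℝ} (ht : |t| ≤ 1) (hy : |y| ≤ 2) :
    ‖Complex.exp ((t * y : ℝ) * Complex.I) -
      (1 + (t * y : ℝ) * Complex.I - ((t * y) ^ 2 / 2 : ℝ))‖ ≤ 64 * |t| ^ 3 := by
  have h := Complex.norm_exp_sub_sum_le_norm_mul_exp ((t * y : ℝ) * Complex.I) 3
  have hs : ∑ m ∈ Finset.range 3, (((t * y : ℝ) : ℂ) * Complex.I) ^ m / (m.factorial : ℂ)
      = 1 + (t * y : ℝ) * Complex.I - ((t * y) ^ 2 / 2 : ℝ) := by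
    simp only [Finset.sum_range_succ, Finset.sum_range_zero, mul_pow, Complex.I_sq,
      Nat.factorial]
    push_cast
    ring
  rw [hs] at h
  refine h.trans ?_
  have hn : ‖((t * y : ℝ) : ℂ) * Complex.I‖ = |t| * |y| := by
    rw [norm_mul, Complex.norm_I, mul_one, Complex.norm_real, Real.norm_eq_abs, abs_mul]
  rw [hn]
  have he : Real.exp (|t| * |y|) ≤ 8 := by
    have h1 : |t| * |y| ≤ 1 * 2 := by gcongr
    have h2 : Real.exp (1 * 2) = Real.exp 1 * Real.exp 1 := by rw [← Real.exp_add]; norm_num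
    have := Real.exp_one_lt_d9
    have h3 := Real.exp_le_exp.2 h1
    nlinarith [Real.exp_pos 1]
  calc (|t| * |y|) ^ 3 * Real.exp (|t| * |y|) ≤ (|t| * 2) ^ 3 * 8 := by gcongr
    _ = 64 * |t| ^ 3 := by ring

/-- The one-step error of the approximate eigenfunction, after subtracting a term whose
conditional expectation vanishes. -/
lemma norm_corrector_step_le {θ a t s x x' : ℝ} (hθ0 : -1 / 3 ≤ θ) (hθ : |θ| ≤ 1)
    (ha : (1 + θ) * a = θ) (ht : |t| ≤ 1)
    (hs : s = 1 ∨ s = -1) (hx : x = 1 ∨ x = -1) (hx' : x' = 1 ∨ x' = -1) :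
    ‖Complex.exp ((t * (x' - θ * s) : ℝ) * Complex.I) * corrector θ t s x'
      - approxEigenvalue θ t * corrector θ t s x
      - ((t * (1 + θ) : ℝ) * Complex.I + (t ^ 2 * ((1 + 2 * θ) * (1 + θ)) * (θ * s) : ℝ))
        * ((x' - a * (s + x) : ℝ) : ℂ)‖ ≤ 1000 * |t| ^ 3 := by
  have hy := abs_sub_mul_le_two hθ hs hx
  have hy' := abs_sub_mul_le_two hθ hs hx'
  have hc := abs_mul_one_add_two_mul_le hθ
  have hs1 : |s| = 1 := by rcases hs with rfl | rfl <;> simp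
  have hquad : (x' - θ * s) ^ 2 = 1 - θ ^ 2 - 2 * (θ * s) * (x' - θ * s) := by
    rcases hs with rfl | rfl <;> rcases hx' with rfl | rfl <;> ring
  have hdiff : x' - a * (s + x) = (x' - θ * s) - a * (x - θ * s) := by linear_combination -s * ha
  have he := norm_exp_mul_I_sub_quadratic_le ht hy'
  have hh : ‖corrector θ t s x'‖ ≤ 9 := by
    have h1 := norm_corrector_sub_one_le hθ ht hs hx'
    have h2 := norm_add_le (corrector θ t s x' - 1) 1
    rw [sub_add_cancel, norm_one] at h2
    linarith
  rw [hdiff]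
  unfold approxEigenvalue
  set y := x - θ * s with hydef
  set y' := x' - θ * s with hydef'
  set E := Complex.exp ((t * y' : ℝ) * Complex.I)
  set m := θ * s with hm
  have hm1 : |m| ≤ 1 := by rw [hm, abs_mul, hs1, mul_one]; exact hθ
  set c := θ * (1 + 2 * θ) with hcdef
  have ht4 : |t| ^ 4 ≤ |t| ^ 3 := pow_le_pow_of_le_one (abs_nonneg t) ht (by norm_num)
  set S := (1 + 2 * θ) * (1 - θ ^ 2) with hS
  have hS3 : |S| ≤ 3 := by
    have hθ2 : θ ^ 2 ≤ 1 := (sq_le_one_iff_abs_le_one θ).2 hθ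
    rw [abs_le] at hθ ⊢
    constructor <;> nlinarith
  have key : E * corrector θ t s x' - ((1 - S * t ^ 2 / 2 : ℝ) : ℂ) * corrector θ t s x
      - ((t * (1 + θ) : ℝ) * Complex.I + (t ^ 2 * ((1 + 2 * θ) * (1 + θ)) * m : ℝ))
        * ((y' - a * y : ℝ) : ℂ)
      = (E - (1 + (t * y' : ℝ) * Complex.I - ((t * y') ^ 2 / 2 : ℝ))) * corrector θ t s x'
        + ((t ^ 3 * (c * m * y' ^ 2 - θ * y' ^ 3 / 2 + S * θ * y / 2) : ℝ) : ℂ) * Complex.I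
        + ((t ^ 4 * (S * c * m * y / 2 - c * m * y' ^ 3 / 2) : ℝ) : ℂ) := by
    have ha' : (1 + (θ : ℂ)) * a = θ := mod_cast ha
    have hquad' : (y' : ℂ) ^ 2 = 1 - (θ : ℂ) ^ 2 - 2 * m * y' := mod_cast hquad
    simp only [corrector, ← hydef, ← hydef', ← hm]
    clear_value y y' m E
    simp only [hcdef, hS]
    push_cast
    linear_combination (t * Complex.I * y + t ^ 2 * (1 + 2 * θ) * m * y) * ha'
      - t ^ 2 * (1 / 2 + θ) * hquad' + t ^ 2 * θ * (y' : ℂ) ^ 2 * Complex.I_sq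
  rw [key]
  have habs : ∀ u v : ℝ, |u - v| ≤ |u| + |v| := fun u v => norm_sub_le u v
  refine norm_add₃_le.trans ?_
  rw [norm_mul, norm_mul, Complex.norm_I, mul_one, Complex.norm_real, Complex.norm_real,
    Real.norm_eq_abs, Real.norm_eq_abs, abs_mul, abs_mul, abs_pow, abs_pow]
  have h1 : |c * m * y' ^ 2 - θ * y' ^ 3 / 2 + S * θ * y / 2| ≤ 3 * 1 * 2 ^ 2 + 1 * 2 ^ 3 / 2
      + 3 * 1 * 2 / 2 := by
    refine (abs_add_le _ _).trans (add_le_add ((habs _ _).trans (add_le_add ?_ ?_)) ?_)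
    all_goals simp only [abs_mul, abs_div, abs_pow, Nat.abs_ofNat]
    all_goals gcongr
  have h2 : |S * c * m * y / 2 - c * m * y' ^ 3 / 2| ≤ 3 * 3 * 1 * 2 / 2 + 3 * 1 * 2 ^ 3 / 2 := by
    refine (habs _ _).trans (add_le_add ?_ ?_)
    all_goals simp only [abs_mul, abs_div, abs_pow, Nat.abs_ofNat]
    all_goals gcongr
  calc _ ≤ 64 * |t| ^ 3 * 9 + |t| ^ 3 * (3 * 1 * 2 ^ 2 + 1 * 2 ^ 3 / 2 + 3 * 1 * 2 / 2)
        + |t| ^ 3 * (3 * 3 * 1 * 2 / 2 + 3 * 1 * 2 ^ 3 / 2) := by gcongr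
    _ ≤ 1000 * |t| ^ 3 := by nlinarith [pow_nonneg (abs_nonneg t) 3]

lemma norm_sub_pow_mul_le {u : ℕ → ℂ} {l : ℂ} {ε : ℝ} (hl : ‖l‖ ≤ 1)
    (hu : ∀ k, ‖u (k + 1) - l * u k‖ ≤ ε) (k : ℕ) : ‖u k - l ^ k * u 0‖ ≤ k * ε := by
  induction k with
  | zero => simp
  | succ k ih =>
    have e : u (k + 1) - l ^ (k + 1) * u 0
        = (u (k + 1) - l * u k) + l * (u k - l ^ k * u 0) := by ring
    have h : ‖l * (u k - l ^ k * u 0)‖ ≤ 1 * (k * ε) := by rw [norm_mul]; gcongr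
    rw [e]
    refine (norm_add_le _ _).trans ?_
    push_cast
    linarith [hu k]

lemma integral_mul_sub_condExp_eq_zero {Ω : Type*} {m mΩ : MeasurableSpace Ω} {μ : Measure Ω}
    [IsFiniteMeasure μ] (hm : m ≤ mΩ) {Z : Ω → ℂ} (hZ : Measurable[m] Z)
    {C : ℝ} (hC : ∀ᵐ ω ∂μ, ‖Z ω‖ ≤ C) {f g : Ω → ℝ} (hf : Integrable f μ) (hg : Integrable g μ)
    (h : μ[f | m] =ᵐ[μ] g) : ∫ ω, Z ω * ((f ω - g ω : ℝ) : ℂ) ∂μ = 0 := by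
  have hZ' : AEStronglyMeasurable Z μ := (hZ.mono hm le_rfl).aestronglyMeasurable
  have hfZ : Integrable (fun ω => Z ω * (f ω : ℂ)) μ := hf.ofReal.bdd_mul hZ' hC
  have hgZ : Integrable (fun ω => Z ω * (g ω : ℂ)) μ := hg.ofReal.bdd_mul hZ' hC
  have key := condExp_bilin_of_stronglyMeasurable_left (μ := μ) (m := m)
    (ContinuousLinearMap.lsmul ℝ ℝ : ℝ →L[ℝ] ℂ →L[ℝ] ℂ).flip (f := Z) (g := f)
    hZ.stronglyMeasurable (by simpa [mul_comm] using hfZ) hf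
  have e : ∫ ω, Z ω * (f ω : ℂ) ∂μ = ∫ ω, Z ω * (g ω : ℂ) ∂μ := by
    calc ∫ ω, Z ω * (f ω : ℂ) ∂μ
        = ∫ ω, (ContinuousLinearMap.lsmul ℝ ℝ : ℝ →L[ℝ] ℂ →L[ℝ] ℂ).flip (Z ω) (f ω) ∂μ := by
          simp [mul_comm]
      _ = ∫ ω, (ContinuousLinearMap.lsmul ℝ ℝ : ℝ →L[ℝ] ℂ →L[ℝ] ℂ).flip (Z ω) (μ[f | m] ω) ∂μ := by
          rw [← integral_congr_ae key, integral_condExp hm]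
      _ = ∫ ω, Z ω * (g ω : ℂ) ∂μ := by
          refine integral_congr_ae ?_
          filter_upwards [h] with ω hω
          simp [hω, mul_comm]
  simp_rw [Complex.ofReal_sub, mul_sub]
  rw [integral_sub hfZ hgZ, e, sub_self]

section Walk

variable {Ω : Type*} {X : ℕ → Ω → ℝ}

lemma measurable_sigmaUpTo {i n : ℕ} (hi : i ∈ Finset.Icc 1 n) : Measurable[sigmaUpTo X n] (X i) :=
  Measurable.mono (comap_measurable (X i))
    (le_iSup₂ (f := fun i (_ : i ∈ Finset.Icc 1 n) =>
      MeasurableSpace.comap (X i) inferInstance) i hi) le_rfl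

/-- The sum of the first `n` steps, recentred at `θ` times the first step. -/
def centeredSum (X : ℕ → Ω → ℝ) (θ : ℝ) (n : ℕ) (ω : Ω) : ℝ :=
  ∑ k ∈ Finset.Icc 1 n, (X k ω - θ * X 1 ω)

lemma centeredSum_eq (θ : ℝ) (n : ℕ) (ω : Ω) :
    centeredSum X θ n ω = partialSum X n ω - n * (θ * X 1 ω) := by
  simp [centeredSum, partialSum, Finset.sum_sub_distrib]

lemma centeredSum_succ (θ : ℝ) (n : ℕ) (ω : Ω) :
    centeredSum X θ (n + 1) ω = centeredSum X θ n ω + (X (n + 1) ω - θ * X 1 ω) :=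
  Finset.sum_Icc_succ_top (by omega) _

lemma measurable_centeredSum_sigmaUpTo (θ : ℝ) (n : ℕ) :
    Measurable[sigmaUpTo X n] (centeredSum X θ n) := by
  refine Finset.measurable_fun_sum _ fun i hi => (measurable_sigmaUpTo hi).sub
    (measurable_const.mul (measurable_sigmaUpTo ?_))
  rw [Finset.mem_Icc] at *
  omega

variable [MeasurableSpace Ω] {μ : Measure Ω}

lemma sigmaUpTo_le (hX : ∀ i, Measurable (X i)) (n : ℕ) :
    sigmaUpTo X n ≤ (inferInstance : MeasurableSpace Ω) :=
  iSup₂_le fun i _ => (hX i).comap_le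

lemma measurable_centeredSum (hX : ∀ i, Measurable (X i)) (θ : ℝ) (n : ℕ) :
    Measurable (centeredSum X θ n) :=
  Finset.measurable_fun_sum _ fun i _ => (hX i).sub (measurable_const.mul (hX 1))

/-- The expectation of the approximate eigenfunction along the walk. -/
def correctedCharFun (μ : Measure Ω) (X : ℕ → Ω → ℝ) (θ t : ℝ) (n : ℕ) : ℂ :=
  ∫ ω, Complex.exp ((t * centeredSum X θ n ω : ℝ) * Complex.I)
    * corrector θ t (X 1 ω) (X n ω) ∂μ

lemma measurable_exp_centeredSum (hX : ∀ i, Measurable (X i)) (θ t : ℝ) (n : ℕ) :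
    Measurable fun ω => Complex.exp ((t * centeredSum X θ n ω : ℝ) * Complex.I) := by
  have := measurable_centeredSum hX θ n
  fun_prop

lemma integrable_exp_centeredSum [IsFiniteMeasure μ] (hX : ∀ i, Measurable (X i)) (θ t : ℝ)
    (n : ℕ) :
    Integrable (fun ω => Complex.exp ((t * centeredSum X θ n ω : ℝ) * Complex.I)) μ :=
  Integrable.of_bound (measurable_exp_centeredSum hX θ t n).aestronglyMeasurable 1
    (ae_of_all _ fun _ => (Complex.norm_exp_ofReal_mul_I _).le)

lemma integrable_exp_mul_corrector [IsFiniteMeasure μ] (hX : ∀ i, Measurable (X i))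
    (hval : ∀ i, 1 ≤ i → ∀ᵐ ω ∂μ, X i ω = 1 ∨ X i ω = -1) {θ t : ℝ} (hθ : |θ| ≤ 1)
    (ht : |t| ≤ 1) {n : ℕ} (hn : 1 ≤ n) :
    Integrable (fun ω => Complex.exp ((t * centeredSum X θ n ω : ℝ) * Complex.I)
      * corrector θ t (X 1 ω) (X n ω)) μ := by
  refine Integrable.mul_bdd (c := 8 * |t| + 1) (integrable_exp_centeredSum hX θ t n) ?_ ?_
  · have h1 := hX 1
    have h2 := hX n
    unfold corrector
    exact Measurable.aestronglyMeasurable (by fun_prop)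
  · filter_upwards [hval 1 le_rfl, hval n hn] with ω h1 h2
    have h3 := norm_add_le (corrector θ t (X 1 ω) (X n ω) - 1) 1
    rw [sub_add_cancel, norm_one] at h3
    linarith [norm_corrector_sub_one_le hθ ht h1 h2]

lemma norm_correctedCharFun_sub_integral_le [IsProbabilityMeasure μ] (hX : ∀ i, Measurable (X i))
    (hval : ∀ i, 1 ≤ i → ∀ᵐ ω ∂μ, X i ω = 1 ∨ X i ω = -1) {θ t : ℝ} (hθ : |θ| ≤ 1)
    (ht : |t| ≤ 1) {n : ℕ} (hn : 1 ≤ n) :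
    ‖correctedCharFun μ X θ t n
      - ∫ ω, Complex.exp ((t * centeredSum X θ n ω : ℝ) * Complex.I) ∂μ‖ ≤ 8 * |t| := by
  unfold correctedCharFun
  rw [← integral_sub (integrable_exp_mul_corrector hX hval hθ ht hn)
    (integrable_exp_centeredSum hX θ t n)]
  refine (norm_integral_le_of_norm_le_const (C := 8 * |t|) ?_).trans (by simp)
  filter_upwards [hval 1 le_rfl, hval n hn] with ω h1 h2
  rw [← mul_sub_one, norm_mul, Complex.norm_exp_ofReal_mul_I, one_mul]
  exact norm_corrector_sub_one_le hθ ht h1 h2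

lemma norm_integral_exp_centeredSum_two_sub_one_le [IsProbabilityMeasure μ]
    (hX : ∀ i, Measurable (X i)) (hval : ∀ i, 1 ≤ i → ∀ᵐ ω ∂μ, X i ω = 1 ∨ X i ω = -1)
    {θ : ℝ} (hθ : |θ| ≤ 1) (t : ℝ) :
    ‖∫ ω, Complex.exp ((t * centeredSum X θ 2 ω : ℝ) * Complex.I) ∂μ - 1‖ ≤ 4 * |t| := by
  have e : ∫ ω, Complex.exp ((t * centeredSum X θ 2 ω : ℝ) * Complex.I) ∂μ - 1
      = ∫ ω, (Complex.exp ((t * centeredSum X θ 2 ω : ℝ) * Complex.I) - 1) ∂μ := by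
    rw [integral_sub (integrable_exp_centeredSum hX θ t 2) (integrable_const _)]
    simp
  rw [e]
  refine (norm_integral_le_of_norm_le_const (C := 4 * |t|) ?_).trans (by simp)
  filter_upwards [hval 1 le_rfl, hval 2 (by norm_num)] with ω h1 h2
  have h := Real.norm_exp_I_mul_ofReal_sub_one_le (x := t * centeredSum X θ 2 ω)
  rw [mul_comm Complex.I] at h
  refine h.trans ?_
  have hT : |centeredSum X θ 2 ω| ≤ 4 := by
    have e2 : centeredSum X θ 2 ω = (X 1 ω - θ * X 1 ω) + (X 2 ω - θ * X 1 ω) := by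
      simp [centeredSum, Finset.sum_Icc_succ_top]
      ring
    rw [e2]
    linarith [abs_add_le (X 1 ω - θ * X 1 ω) (X 2 ω - θ * X 1 ω),
      abs_sub_mul_le_two hθ h1 h1, abs_sub_mul_le_two hθ h1 h2]
  rw [Real.norm_eq_abs, abs_mul, mul_comm]
  gcongr

lemma norm_correctedCharFun_succ_sub_le [IsProbabilityMeasure μ] (hX : ∀ i, Measurable (X i))
    (hval : ∀ i, 1 ≤ i → ∀ᵐ ω ∂μ, X i ω = 1 ∨ X i ω = -1) {θ a t : ℝ} (hθ0 : -1 / 3 ≤ θ)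
    (hθ : |θ| ≤ 1) (ha : (1 + θ) * a = θ) (ht : |t| ≤ 1) {n : ℕ} (hn : 1 ≤ n)
    (hcond : μ[X (n + 1) | sigmaUpTo X n] =ᵐ[μ] fun ω => a * (X 1 ω + X n ω)) :
    ‖correctedCharFun μ X θ t (n + 1) - approxEigenvalue θ t * correctedCharFun μ X θ t n‖
      ≤ 1000 * |t| ^ 3 := by
  have hint : ∀ i, 1 ≤ i → Integrable (X i) μ := fun i hi =>
    Integrable.of_bound (hX i).aestronglyMeasurable 1 <| by
      filter_upwards [hval i hi] with ω h
      rcases h with h | h <;> simp [h]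
  set b : ℝ → ℂ := fun s =>
    (t * (1 + θ) : ℝ) * Complex.I + (t ^ 2 * ((1 + 2 * θ) * (1 + θ)) * (θ * s) : ℝ) with hb
  set F : Ω → ℂ := fun ω => Complex.exp ((t * centeredSum X θ n ω : ℝ) * Complex.I) with hF
  have hZ : Measurable[sigmaUpTo X n] fun ω => F ω * b (X 1 ω) := by
    have h1 := measurable_centeredSum_sigmaUpTo (X := X) θ n
    have h2 : Measurable[sigmaUpTo X n] (X 1) := measurable_sigmaUpTo (by simpa using hn)
    have h3 : Measurable b := by fun_prop
    have h4 : Measurable fun x : ℝ => Complex.exp ((t * x : ℝ) * Complex.I) := by fun_prop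
    exact (h4.comp h1).mul (h3.comp h2)
  have hZb : ∀ᵐ ω ∂μ, ‖F ω * b (X 1 ω)‖ ≤ ‖b 1‖ + ‖b (-1)‖ := by
    filter_upwards [hval 1 le_rfl] with ω h
    rw [norm_mul, hF, Complex.norm_exp_ofReal_mul_I, one_mul]
    rcases h with h | h <;> rw [h] <;> linarith [norm_nonneg (b 1), norm_nonneg (b (-1))]
  have hg : Integrable (fun ω => a * (X 1 ω + X n ω)) μ :=
    ((hint 1 le_rfl).add (hint n hn)).const_mul a
  have hf := hint (n + 1) (by omega)
  have h0 := integral_mul_sub_condExp_eq_zero (sigmaUpTo_le hX n) hZ hZb hf hg hcond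
  have hZi : Integrable (fun ω => F ω * b (X 1 ω)
      * ((X (n + 1) ω - a * (X 1 ω + X n ω) : ℝ) : ℂ)) μ :=
    (hf.sub hg).ofReal.bdd_mul (hZ.mono (sigmaUpTo_le hX n) le_rfl).aestronglyMeasurable hZb
  have hi1 := integrable_exp_mul_corrector hX hval hθ ht (n := n + 1) (by omega)
  have hi0 := (integrable_exp_mul_corrector hX hval hθ ht hn).const_mul
    (approxEigenvalue θ t : ℂ)
  unfold correctedCharFun
  rw [← integral_const_mul, ← integral_sub hi1 hi0, ← sub_zero (∫ ω, _ ∂μ), ← h0]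
  have hsub := integral_sub (hi1.sub hi0) hZi
  simp only [Pi.sub_apply] at hsub
  rw [← hsub]
  refine (norm_integral_le_of_norm_le_const (C := 1000 * |t| ^ 3) ?_).trans (by simp)
  filter_upwards [hval 1 le_rfl, hval n hn, hval (n + 1) (by omega)] with ω h1 h2 h3
  have h := norm_corrector_step_le hθ0 hθ ha ht h1 h2 h3
  have e : Complex.exp ((t * centeredSum X θ (n + 1) ω : ℝ) * Complex.I)
      = F ω * Complex.exp ((t * (X (n + 1) ω - θ * X 1 ω) : ℝ) * Complex.I) := by
    rw [hF, ← Complex.exp_add, ← add_mul, ← Complex.ofReal_add, ← mul_add, centeredSum_succ]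
  rw [e]
  refine le_trans (le_of_eq ?_) h
  have hFn : ∀ w : ℂ, ‖w‖ = ‖F ω * w‖ := fun w => by
    rw [norm_mul, hF, Complex.norm_exp_ofReal_mul_I, one_mul]
  refine Eq.trans ?_ (hFn _).symm
  congr 1
  simp only [hF, hb]
  ring

/-- A quantitative approximation of the characteristic function of the recentred walk. -/
lemma norm_integral_exp_centeredSum_sub_pow_le [IsProbabilityMeasure μ]
    (hX : ∀ i, Measurable (X i)) (hval : ∀ i, 1 ≤ i → ∀ᵐ ω ∂μ, X i ω = 1 ∨ X i ω = -1)
    {θ a t : ℝ} (hθ0 : -1 / 3 ≤ θ) (hθ : |θ| ≤ 1) (ha : (1 + θ) * a = θ) (ht : |t| ≤ 1)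
    (hcond : ∀ n, 2 ≤ n →
      μ[X (n + 1) | sigmaUpTo X n] =ᵐ[μ] fun ω => a * (X 1 ω + X n ω)) (k : ℕ) :
    ‖∫ ω, Complex.exp ((t * centeredSum X θ (k + 2) ω : ℝ) * Complex.I) ∂μ
      - (approxEigenvalue θ t : ℂ) ^ k‖ ≤ 20 * |t| + k * (1000 * |t| ^ 3) := by
  have hl : ‖(approxEigenvalue θ t : ℂ)‖ ≤ 1 := by
    simpa using abs_approxEigenvalue_le_one hθ0 hθ ht
  have h1 := norm_correctedCharFun_sub_integral_le hX hval hθ ht (n := k + 2) (by omega)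
  have h2 := norm_sub_pow_mul_le (u := fun j => correctedCharFun μ X θ t (j + 2)) hl
    (fun j => norm_correctedCharFun_succ_sub_le hX hval hθ0 hθ ha ht (by omega)
      (hcond (j + 2) (by omega))) k
  have h3 := norm_correctedCharFun_sub_integral_le hX hval hθ ht (n := 2) (by omega)
  have h4 := norm_integral_exp_centeredSum_two_sub_one_le hX hval hθ t
  have h5 : ‖correctedCharFun μ X θ t 2 - 1‖ ≤ 12 * |t| := by
    refine (norm_sub_le_norm_sub_add_norm_sub _ _ _).trans (add_le_add h3 h4) |>.trans ?_
    linarith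
  have h6 : ‖(approxEigenvalue θ t : ℂ) ^ k * (correctedCharFun μ X θ t 2 - 1)‖
      ≤ 1 * (12 * |t|) := by
    rw [norm_mul, norm_pow]
    gcongr
    exact pow_le_one₀ (norm_nonneg _) hl
  rw [norm_sub_rev] at h1
  refine (norm_sub_le_norm_sub_add_norm_sub _ (correctedCharFun μ X θ t (k + 2)) _).trans ?_
  have h7 := norm_sub_le_norm_sub_add_norm_sub (correctedCharFun μ X θ t (k + 2))
    ((approxEigenvalue θ t : ℂ) ^ k * correctedCharFun μ X θ t 2) ((approxEigenvalue θ t : ℂ) ^ k)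
  rw [← mul_sub_one] at h7
  simp only [zero_add] at h2
  linarith

lemma tendsto_integral_exp_centeredSum [IsProbabilityMeasure μ]
    (hX : ∀ i, Measurable (X i)) (hval : ∀ i, 1 ≤ i → ∀ᵐ ω ∂μ, X i ω = 1 ∨ X i ω = -1)
    {θ a σ : ℝ} (hθ0 : -1 / 3 ≤ θ) (hθ : |θ| ≤ 1) (ha : (1 + θ) * a = θ)
    (hcond : ∀ n, 2 ≤ n →
      μ[X (n + 1) | sigmaUpTo X n] =ᵐ[μ] fun ω => a * (X 1 ω + X n ω))
    (hσ0 : 0 < σ) (hσ : σ ^ 2 = (1 + 2 * θ) * (1 - θ ^ 2)) (t : ℝ) :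
    Tendsto (fun n : ℕ => ∫ ω,
      Complex.exp ((t / (σ * Real.sqrt n) * centeredSum X θ n ω : ℝ) * Complex.I) ∂μ) atTop
      (𝓝 (Complex.exp (-t ^ 2 / 2))) := by
  rw [← tendsto_add_atTop_iff_nat 2]
  set τ : ℕ → ℝ := fun k => t / (σ * Real.sqrt ((k + 2 : ℕ) : ℝ)) with hτ
  have hN : Tendsto (fun k : ℕ => ((k + 2 : ℕ) : ℝ)) atTop atTop :=
    tendsto_natCast_atTop_atTop.comp (tendsto_add_atTop_nat 2)
  have hτ0 : Tendsto τ atTop (𝓝 0) :=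
    tendsto_const_nhds.div_atTop ((Real.tendsto_sqrt_atTop.comp hN).const_mul_atTop hσ0)
  have hτ2 : ∀ k, τ k ^ 2 = (t / σ) ^ 2 / ((k + 2 : ℕ) : ℝ) := fun k => by
    simp only [hτ]
    rw [div_pow, mul_pow, Real.sq_sqrt (by positivity), div_pow, div_div]
  have hkτ : Tendsto (fun k : ℕ => (k : ℝ) * τ k ^ 2) atTop (𝓝 ((t / σ) ^ 2)) := by
    have h := (tendsto_natCast_div_add_atTop (𝕜 := ℝ) 2).const_mul ((t / σ) ^ 2)
    rw [mul_one] at h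
    refine h.congr fun k => ?_
    rw [hτ2]
    push_cast
    ring
  have hpow : Tendsto (fun k : ℕ => (approxEigenvalue θ (τ k) : ℂ) ^ k) atTop
      (𝓝 (Complex.exp (-t ^ 2 / 2))) := by
    have hg : Tendsto (fun k : ℕ => (k : ℝ) * (-(σ ^ 2 * τ k ^ 2 / 2))) atTop
        (𝓝 (-t ^ 2 / 2)) := by
      have h := hkτ.const_mul (-(σ ^ 2 / 2))
      have e : -(σ ^ 2 / 2) * (t / σ) ^ 2 = -t ^ 2 / 2 := by field_simp
      rw [e] at h
      exact h.congr fun k => by ring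
    have h := (Complex.continuous_ofReal.tendsto _).comp
      (Real.tendsto_one_add_pow_exp_of_tendsto hg)
    push_cast at h
    refine h.congr fun k => ?_
    simp only [Function.comp, approxEigenvalue, ← hσ]
    push_cast
    ring
  have hbound : Tendsto (fun k : ℕ => 20 * |τ k| + k * (1000 * |τ k| ^ 3)) atTop (𝓝 0) := by
    have h := (hτ0.abs.const_mul 20).add ((hkτ.mul hτ0.abs).const_mul 1000)
    simp only [abs_zero, mul_zero, add_zero] at h
    refine h.congr fun k => ?_
    rw [← sq_abs (τ k)]
    ring
  have hsmall : ∀ᶠ k in atTop, |τ k| ≤ 1 := by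
    have h := hτ0.abs
    rw [abs_zero] at h
    exact h.eventually_le_const one_pos
  have hdiff := squeeze_zero_norm' (hsmall.mono fun k hk =>
    norm_integral_exp_centeredSum_sub_pow_le hX hval hθ0 hθ ha hk hcond k) hbound
  refine (hdiff.add hpow).congr' ?_ |>.trans (by rw [zero_add])
  exact Eventually.of_forall fun k => sub_add_cancel _ _

end Walk

/-- for the elephant random walk remembering the first and the most recent
step: `(Sₙ - n(2p-1)X₁/(3-2p))/(σ_T√n) → N(0,1)` in distribution, where
`σ_T² = 1 + (2p-1)(4p²-24p+19)/(3-2p)³`. -/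
theorem elephant_first_and_last_step_clt
    {Ω : Type*} [MeasurableSpace Ω] (μ : Measure Ω) [IsProbabilityMeasure μ]
    (p : ℝ) (hp0 : 0 < p) (hp1 : p < 1)
    (X : ℕ → Ω → ℝ)
    (hXmeas : ∀ i, Measurable (X i))
    (hval : ∀ i, 1 ≤ i → ∀ᵐ ω ∂μ, X i ω = 1 ∨ X i ω = -1)
    (hinit : μ {ω | X 1 ω = 1} = ENNReal.ofReal p)
    (hcond1 : μ[X 2 | sigmaUpTo X 1] =ᵐ[μ] fun ω => (2*p-1) * X 1 ω)
    (hcond : ∀ n, 2 ≤ n →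
      μ[X (n+1) | sigmaUpTo X n] =ᵐ[μ] fun ω => (2*p-1) * (X 1 ω + X n ω) / 2) :
    TendstoInDistribution μ
      (fun n ω => (partialSum X n ω - n*(2*p-1)*X 1 ω/(3-2*p)) /
        (Real.sqrt (1 + (2*p-1)*(4*p^2-24*p+19)/(3-2*p)^3) * Real.sqrt n))
      (gaussianReal 0 1) := by

  have hq : 0 < 3 - 2 * p := by linarith
  set θ : ℝ := (2 * p - 1) / (3 - 2 * p) with hθdef
  have hθ0 : -1 / 3 ≤ θ := by rw [hθdef, div_le_div_iff₀ (by norm_num) hq]; linarith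
  have hθ1 : θ < 1 := by rw [hθdef, div_lt_one hq]; linarith
  have hθ : |θ| ≤ 1 := abs_le.2 ⟨by linarith, hθ1.le⟩
  have ha : (1 + θ) * ((2 * p - 1) / 2) = θ := by rw [hθdef]; field_simp; ring
  have hvar : 1 + (2*p-1)*(4*p^2-24*p+19)/(3-2*p)^3 = (1 + 2 * θ) * (1 - θ ^ 2) := by
    rw [hθdef]; field_simp; ring
  have hpos : 0 < (1 + 2 * θ) * (1 - θ ^ 2) := mul_pos (by linarith) (by nlinarith)
  rw [hvar]
  set σ := Real.sqrt ((1 + 2 * θ) * (1 - θ ^ 2)) with hσdef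
  have hlim := tendsto_integral_exp_centeredSum hXmeas hval hθ0 hθ ha
    (fun n hn => (hcond n hn).trans (ae_of_all _ fun ω => by ring))
    (Real.sqrt_pos.2 hpos) (Real.sq_sqrt hpos.le)
  have hf : ∀ n ω, (partialSum X n ω - n*(2*p-1)*X 1 ω/(3-2*p)) / (σ * Real.sqrt n)
      = centeredSum X θ n ω / (σ * Real.sqrt n) := fun n ω => by
    rw [centeredSum_eq, hθdef]; ring
  simp_rw [hf]
  have hmeas : ∀ n : ℕ, Measurable fun ω => centeredSum X θ n ω / (σ * Real.sqrt n) :=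
    fun n => (measurable_centeredSum hXmeas θ n).div_const _
  let P : ℕ → ProbabilityMeasure ℝ := fun n =>
    ⟨μ.map fun ω => centeredSum X θ n ω / (σ * Real.sqrt n),
      Measure.isProbabilityMeasure_map (hmeas n).aemeasurable⟩
  let G : ProbabilityMeasure ℝ := ⟨gaussianReal 0 1, inferInstance⟩
  have hP : Tendsto P atTop (𝓝 G) := by
    refine ProbabilityMeasure.tendsto_iff_tendsto_charFun.2 fun t => ?_
    have hG : charFun (G : Measure ℝ) t = Complex.exp (-t ^ 2 / 2) := by
      simp [G, charFun_gaussianReal, neg_div]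
    rw [hG]
    refine (hlim t).congr fun n => ?_
    simp only [P, ProbabilityMeasure.coe_mk]
    rw [charFun_apply_real, integral_map (hmeas n).aemeasurable
      (Measurable.aestronglyMeasurable (by fun_prop))]
    refine integral_congr_ae (ae_of_all _ fun ω => ?_)
    simp only [σ]
    congr 2
    push_cast
    ring
  intro g
  have h := ProbabilityMeasure.tendsto_iff_forall_integral_tendsto.1 hP g
  refine h.congr fun n => ?_
  exact integral_map (hmeas n).aemeasurable g.continuous.measurable.aestronglyMeasurable
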